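/- (Diamagnetic consequence) Let n ≥ 3 and b ∈ L^{n,∞}(Ω; ℝⁿ). Then for v ∈ C_c^∞(Ω) the magnetic and free gradients have equivalent L² norms: ‖∇^b v‖_{L²(Ω)} ≃ ‖∇ v‖_{L²(Ω)}, with constants depending only on n and ‖b‖_{L^{n,∞}}. -/

import Mathlib

open MeasureTheory ENNReal

/-- The weak-`Lⁿ` (Lorentz `L^{n,∞}`) quasinorm of a vector field `b` on `ℝⁿ`:
`sup_{t>0} t · |{ |b| > t }|^{1/n}`. -/
noncomputable def weakLn (n : ℕ)
    (b : EuclideanSpace ℝ (Fin n) → EuclideanSpace ℝ (Fin n)) : ℝ≥0∞ :=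
  ⨆ t ∈ Set.Ioi (0 : ℝ),
    ENNReal.ofReal t * (volume {x : EuclideanSpace ℝ (Fin n) | t < ‖b x‖}) ^ ((n : ℝ)⁻¹)

/-- The squared length of `∇|v|`, written as `∑ⱼ (Re (conj v ∂ⱼ v) / |v|)²`. -/
noncomputable def gradNormSq {n : ℕ} (v : EuclideanSpace ℝ (Fin n) → ℂ)
    (x : EuclideanSpace ℝ (Fin n)) : ℝ≥0∞ :=
  ∑ j, ‖inner ℝ (v x) (fderiv ℝ v x (EuclideanSpace.single j 1)) / ‖v x‖‖ₑ ^ 2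

lemma exists_contDiff_cutoff : ∃ (ψ : ℝ → ℝ) (M : ℝ), ContDiff ℝ 1 ψ ∧ (∀ s ≤ 1, ψ s = 0) ∧
    (∀ s, 4 ≤ s → ψ s = 1) ∧ (∀ s, |deriv ψ s| ≤ M) ∧ ∀ s, s ∉ Set.Ioo 1 4 → deriv ψ s = 0 := by
  let ψ : ℝ → ℝ := fun s => Real.smoothTransition ((s - 1) / 3)
  have h_smooth : ContDiff ℝ 1 ψ :=
    (Real.smoothTransition.contDiff (n := 1)).comp (by fun_prop)
  have h_zero : ∀ s ≤ 1, ψ s = 0 := fun s hs =>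
    Real.smoothTransition.zero_of_nonpos (by linarith)
  have h_one : ∀ s, 4 ≤ s → ψ s = 1 := fun s hs =>
    Real.smoothTransition.one_of_one_le (by linarith)
  have h_deriv : ∀ s, s ∉ Set.Ioo 1 4 → deriv ψ s = 0 := by
    intro s hs
    by_cases h : s ≤ 1
    · refine IsLocalMin.deriv_eq_zero (Filter.Eventually.of_forall fun t => ?_)
      rw [h_zero s h]
      exact Real.smoothTransition.nonneg _
    · have h4 : 4 ≤ s := by
        by_contra h4
        exact hs ⟨not_le.1 h, not_le.1 h4⟩
      refine IsLocalMax.deriv_eq_zero (Filter.Eventually.of_forall fun t => ?_)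
      rw [h_one s h4]
      exact Real.smoothTransition.le_one _
  obtain ⟨M, hM⟩ := isCompact_Icc.exists_bound_of_continuousOn (s := Set.Icc (1 : ℝ) 4)
    (h_smooth.continuous_deriv le_rfl).continuousOn
  refine ⟨ψ, M, h_smooth, h_zero, h_one, fun s => ?_, h_deriv⟩
  by_cases hs : s ∈ Set.Ioo 1 4
  · exact hM s (Set.Ioo_subset_Icc_self hs)
  · rw [h_deriv s hs, abs_zero]
    exact (norm_nonneg _).trans (hM 1 (by norm_num))

lemma enorm_sq_le_sum_enorm_sq_apply_single {n : ℕ} (L : EuclideanSpace ℝ (Fin n) →L[ℝ] ℝ) :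
    ‖L‖ₑ ^ 2 ≤ ∑ j, ‖L (EuclideanSpace.single j 1)‖ₑ ^ 2 := by
  have h_nonneg : (0 : ℝ) ≤ ∑ j, ‖L (EuclideanSpace.single j 1)‖ ^ 2 :=
    Finset.sum_nonneg fun _ _ => sq_nonneg _
  have h_le : ‖L‖ ≤ √(∑ j, ‖L (EuclideanSpace.single j 1)‖ ^ 2) := by
    refine L.opNorm_le_bound (Real.sqrt_nonneg _) fun x => ?_
    have hx : L x = ∑ j, x j * L (EuclideanSpace.single j 1) := by
      conv_lhs => rw [← (EuclideanSpace.basisFun (Fin n) ℝ).sum_repr x, map_sum]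
      simp
    rw [hx, EuclideanSpace.norm_eq, ← Real.sqrt_mul h_nonneg]
    refine Real.le_sqrt_of_sq_le ?_
    rw [Real.norm_eq_abs, sq_abs, mul_comm]
    simpa using Finset.sum_mul_sq_le_sq_mul_sq Finset.univ (fun j => x j)
      (fun j => L (EuclideanSpace.single j 1))
  have h_sq : ‖L‖ ^ 2 ≤ ∑ j, ‖L (EuclideanSpace.single j 1)‖ ^ 2 :=
    (Real.le_sqrt (norm_nonneg _) h_nonneg).1 h_le
  have := ENNReal.ofReal_le_ofReal h_sq
  rw [ENNReal.ofReal_sum_of_nonneg fun _ _ => sq_nonneg _] at this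
  simpa only [ENNReal.ofReal_pow (norm_nonneg _), ofReal_norm] using this

lemma enorm_sq_fderiv_cutoff_le {n : ℕ} {ψ : ℝ → ℝ} {M : ℝ} (hψ : ContDiff ℝ 1 ψ)
    (hM : ∀ s, |deriv ψ s| ≤ M) (hψ' : ∀ s, s ∉ Set.Ioo 1 4 → deriv ψ s = 0)
    {v : EuclideanSpace ℝ (Fin n) → ℂ} (hv : Differentiable ℝ v) {a : ℝ} (ha : 0 < a)
    (x : EuclideanSpace ℝ (Fin n)) :
    ‖fderiv ℝ (fun y => ψ (‖v y‖ ^ 2 / a ^ 2)) x‖ₑ ^ 2 ≤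
      {y | a ≤ ‖v y‖ ∧ ‖v y‖ < 2 * a}.indicator
        (fun y => ENNReal.ofReal ((4 * M) ^ 2 / a ^ 2) * gradNormSq v y) x := by
  have h_fderiv : HasFDerivAt (fun y => ψ (‖v y‖ ^ 2 / a ^ 2))
      (deriv ψ (‖v x‖ ^ 2 / a ^ 2) • ((a ^ 2)⁻¹ • (2 • (innerSL ℝ) (v x) ∘SL fderiv ℝ v x))) x := by
    have h₁ := ((hv x).hasFDerivAt.norm_sq).mul_const (a ^ 2)⁻¹
    have h₂ := (hψ.differentiable one_ne_zero (‖v x‖ ^ 2 / a ^ 2)).hasDerivAt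
    simp only [div_eq_mul_inv] at h₂ ⊢
    exact h₂.comp_hasFDerivAt x h₁
  rw [h_fderiv.fderiv]
  by_cases hx : ‖v x‖ ^ 2 / a ^ 2 ∈ Set.Ioo 1 4
  · have h_lo : a < ‖v x‖ := by
      have := (one_lt_div (by positivity)).1 hx.1
      exact lt_of_pow_lt_pow_left₀ 2 (norm_nonneg _) this
    have h_hi : ‖v x‖ < 2 * a := by
      have := (div_lt_iff₀ (by positivity)).1 hx.2
      exact lt_of_pow_lt_pow_left₀ 2 (by positivity) (by linarith)
    rw [Set.indicator_of_mem (show x ∈ {y | a ≤ ‖v y‖ ∧ ‖v y‖ < 2 * a} from ⟨h_lo.le, h_hi⟩)]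
    refine (enorm_sq_le_sum_enorm_sq_apply_single _).trans ?_
    rw [gradNormSq, Finset.mul_sum]
    refine Finset.sum_le_sum fun j _ => ?_
    simp only [← ofReal_norm]
    rw [← ENNReal.ofReal_pow (norm_nonneg _), ← ENNReal.ofReal_pow (norm_nonneg _),
      ← ENNReal.ofReal_mul (by positivity)]
    refine ENNReal.ofReal_le_ofReal ?_
    have hv_pos : 0 < ‖v x‖ := ha.trans h_lo
    simp only [smul_apply, ContinuousLinearMap.comp_apply, innerSL_apply_apply,
      smul_eq_mul, nsmul_eq_mul, Real.norm_eq_abs, sq_abs]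
    set i := inner ℝ (v x) (fderiv ℝ v x (EuclideanSpace.single j 1))
    set d := deriv ψ (‖v x‖ ^ 2 / a ^ 2)
    have hd : d ^ 2 ≤ M ^ 2 := sq_le_sq' (by linarith [neg_abs_le d, hM (‖v x‖ ^ 2 / a ^ 2)])
      ((le_abs_self _).trans (hM _))
    calc (d * ((a ^ 2)⁻¹ * (((2 : ℕ) : ℝ) * i))) ^ 2
        = d ^ 2 * ‖v x‖ ^ 2 * (4 * (i / ‖v x‖) ^ 2 / a ^ 4) := by
          push_cast
          field_simp
          ring
      _ ≤ M ^ 2 * (2 * a) ^ 2 * (4 * (i / ‖v x‖) ^ 2 / a ^ 4) := by gcongr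
      _ = (4 * M) ^ 2 / a ^ 2 * (i / ‖v x‖) ^ 2 := by
          field_simp
          ring
  · rw [hψ' _ hx, zero_smul]
    have h_zero : ‖(0 : EuclideanSpace ℝ (Fin n) →L[ℝ] ℝ)‖ₑ ^ 2 = 0 := by
      rw [← ofReal_norm, norm_zero, ENNReal.ofReal_zero, zero_pow two_ne_zero]
    exact h_zero.le.trans zero_le

lemma exists_measure_superlevel_rpow_le {n : ℕ} (hn : 3 ≤ n) : ∃ S : NNReal,
    ∀ v : EuclideanSpace ℝ (Fin n) → ℂ, ContDiff ℝ 1 v → HasCompactSupport v →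
    ∀ a : ℝ, 0 < a → volume {x | 2 * a ≤ ‖v x‖} ^ (((n : ℝ) - 2) / n) ≤
      S * ENNReal.ofReal (1 / a ^ 2) *
        ∫⁻ x in {x | a ≤ ‖v x‖ ∧ ‖v x‖ < 2 * a}, gradNormSq v x := by
  obtain ⟨ψ, M, hψ, hψ_zero, hψ_one, hM, hψ'⟩ := exists_contDiff_cutoff
  have hn' : (3 : ℝ) ≤ n := by exact_mod_cast hn
  let p : NNReal := Real.toNNReal (2 * n / (n - 2))
  have hp : (p : ℝ) = 2 * n / (n - 2) :=
    Real.coe_toNNReal _ (div_nonneg (by linarith) (by linarith))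
  have hp_pos : 0 < (p : ℝ) := by
    rw [hp]
    exact div_pos (by linarith) (by linarith)
  let c : NNReal := SNormLESNormFDerivOfEqConst ℝ
    (volume : Measure (EuclideanSpace ℝ (Fin n))) ((2 : NNReal) : ℝ)
  refine ⟨c ^ 2 * Real.toNNReal ((4 * M) ^ 2), fun v hv hv_supp a ha => ?_⟩
  let u : EuclideanSpace ℝ (Fin n) → ℝ := fun y => ψ (‖v y‖ ^ 2 / a ^ 2)
  have hu : ContDiff ℝ 1 u := hψ.comp ((hv.norm_sq ℝ).div_const _)
  have hu_supp : HasCompactSupport u :=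
    hv_supp.comp_left (g := fun z : ℂ => ψ (‖z‖ ^ 2 / a ^ 2)) (hψ_zero _ (by simp))
  have h_sobolev : eLpNorm u p volume ≤ c * eLpNorm (fderiv ℝ u) (2 : NNReal) volume := by
    refine eLpNorm_le_eLpNorm_fderiv_of_eq volume hu hu_supp (by norm_num) ?_ ?_
    · rw [finrank_euclideanSpace_fin]
      omega
    · rw [finrank_euclideanSpace_fin, hp]
      have : (n : ℝ) - 2 ≠ 0 := by linarith
      field_simp
      push_cast
      ring
  have h_cheb : volume {x | 2 * a ≤ ‖v x‖} ^ (1 / (p : ℝ)) ≤ eLpNorm u p volume := by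
    refine le_trans ?_ (pow_mul_meas_ge_le_eLpNorm volume (p := p) ?_ ENNReal.coe_ne_top
      hu.continuous.aestronglyMeasurable 1)
    · rw [one_mul, ENNReal.coe_toReal]
      refine ENNReal.rpow_le_rpow (measure_mono fun x (hx : 2 * a ≤ ‖v x‖) => ?_) (by positivity)
      have : u x = 1 := hψ_one _ <| by
        rw [le_div_iff₀ (by positivity)]
        nlinarith
      simp [this]
    · exact ENNReal.coe_ne_zero.2 fun h => hp_pos.ne' (by simp [h])
  have h_meas : MeasurableSet {x | a ≤ ‖v x‖ ∧ ‖v x‖ < 2 * a} := by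
    have := hv.continuous.norm.measurable
    exact (measurableSet_le measurable_const this).inter (measurableSet_lt this measurable_const)
  have h_energy : eLpNorm (fderiv ℝ u) (2 : NNReal) volume ^ 2 ≤
      ENNReal.ofReal ((4 * M) ^ 2 / a ^ 2) *
        ∫⁻ x in {x | a ≤ ‖v x‖ ∧ ‖v x‖ < 2 * a}, gradNormSq v x := by
    rw [eLpNorm_nnreal_eq_lintegral two_ne_zero, ← ENNReal.rpow_natCast, ← ENNReal.rpow_mul,
      ← lintegral_const_mul' _ _ ENNReal.ofReal_ne_top, ← lintegral_indicator h_meas]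
    norm_num
    refine lintegral_mono fun x => ?_
    exact enorm_sq_fderiv_cutoff_le hψ hM hψ' (hv.differentiable one_ne_zero) ha x
  calc volume {x | 2 * a ≤ ‖v x‖} ^ (((n : ℝ) - 2) / n)
      = (volume {x | 2 * a ≤ ‖v x‖} ^ (1 / (p : ℝ))) ^ 2 := by
        rw [← ENNReal.rpow_natCast, ← ENNReal.rpow_mul, hp]
        congr 1
        field_simp
        rw [Nat.cast_two, mul_comm]
    _ ≤ (c * eLpNorm (fderiv ℝ u) (2 : NNReal) volume) ^ 2 := by
        gcongr
        exact h_cheb.trans h_sobolev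
    _ ≤ c ^ 2 * (ENNReal.ofReal ((4 * M) ^ 2 / a ^ 2) *
        ∫⁻ x in {x | a ≤ ‖v x‖ ∧ ‖v x‖ < 2 * a}, gradNormSq v x) := by
        rw [mul_pow]
        gcongr
    _ = _ := by
        rw [← mul_assoc, div_eq_mul_one_div ((4 * M) ^ 2), ENNReal.ofReal_mul (by positivity)]
        push_cast
        rw [ENNReal.ofReal]
        ring

/-- A measurable majorant of `|b|²`, built from the dyadic superlevel sets of `|b|`. -/
noncomputable def dyadicMajorant {n : ℕ}
    (b : EuclideanSpace ℝ (Fin n) → EuclideanSpace ℝ (Fin n))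
    (x : EuclideanSpace ℝ (Fin n)) : ℝ≥0∞ :=
  ∑' k : ℤ, (toMeasurable volume {y | (2 : ℝ) ^ k < ‖b y‖}).indicator
    (fun _ => ENNReal.ofReal (4 * ((2 : ℝ) ^ k) ^ 2)) x

lemma measurable_dyadicMajorant {n : ℕ}
    (b : EuclideanSpace ℝ (Fin n) → EuclideanSpace ℝ (Fin n)) :
    Measurable (dyadicMajorant b) :=
  Measurable.tsum fun _ => measurable_const.indicator (measurableSet_toMeasurable _ _)

lemma enorm_sq_le_dyadicMajorant {n : ℕ}
    (b : EuclideanSpace ℝ (Fin n) → EuclideanSpace ℝ (Fin n)) (x : EuclideanSpace ℝ (Fin n)) :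
    ‖b x‖ₑ ^ 2 ≤ dyadicMajorant b x := by
  rcases (norm_nonneg (b x)).eq_or_lt with h | h
  · rw [← ofReal_norm, ← h]
    simp
  · obtain ⟨k, hk, hk'⟩ := _root_.exists_mem_Ioc_zpow h (one_lt_two (α := ℝ))
    refine le_trans ?_ (ENNReal.le_tsum k)
    rw [Set.indicator_of_mem (subset_toMeasurable volume {y | (2 : ℝ) ^ k < ‖b y‖} hk),
      ← ofReal_norm, ← ENNReal.ofReal_pow h.le]
    refine ENNReal.ofReal_le_ofReal ?_
    rw [zpow_add_one₀ two_ne_zero] at hk'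
    nlinarith

lemma measure_superlevel_le_of_weakLn_le {n : ℕ} (hn : n ≠ 0) {B : ℝ} (hB : 0 ≤ B)
    {b : EuclideanSpace ℝ (Fin n) → EuclideanSpace ℝ (Fin n)}
    (hb : weakLn n b ≤ ENNReal.ofReal B) {t : ℝ} (ht : 0 < t) :
    volume {x | t < ‖b x‖} ≤ ENNReal.ofReal ((B / t) ^ n) := by
  have h : ENNReal.ofReal t * volume {x | t < ‖b x‖} ^ ((n : ℝ)⁻¹) ≤ ENNReal.ofReal B :=
    (le_iSup₂ (f := fun (t : ℝ) (_ : t ∈ Set.Ioi (0 : ℝ)) => ENNReal.ofReal t *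
      volume {x : EuclideanSpace ℝ (Fin n) | t < ‖b x‖} ^ ((n : ℝ)⁻¹)) t ht).trans hb
  have h' : volume {x | t < ‖b x‖} ^ ((n : ℝ)⁻¹) ≤ ENNReal.ofReal (B / t) := by
    rw [ENNReal.ofReal_div_of_pos ht, ENNReal.le_div_iff_mul_le (by simp [ht]) (by simp), mul_comm]
    exact h
  calc volume {x | t < ‖b x‖} = (volume {x | t < ‖b x‖} ^ ((n : ℝ)⁻¹)) ^ n := by
        rw [← ENNReal.rpow_natCast, ← ENNReal.rpow_mul,
          inv_mul_cancel₀ (Nat.cast_ne_zero.2 hn), ENNReal.rpow_one]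
    _ ≤ ENNReal.ofReal (B / t) ^ n := by gcongr
    _ = _ := (ENNReal.ofReal_pow (by positivity) n).symm

lemma sq_mul_min_div_pow_le {n : ℕ} (hn : 3 ≤ n) {B ρ t : ℝ} (hB : 0 < B) (hρ : 0 < ρ)
    (ht : 0 < t) :
    t ^ 2 * min ((B / t) ^ n) (ρ ^ n) ≤
      B ^ 2 * ρ ^ (n - 2) * min (B / ρ / t) (t / (B / ρ)) := by
  obtain ⟨m, rfl⟩ := Nat.exists_eq_add_of_le hn
  have h_exp : 3 + m - 2 = m + 1 := by omega
  rw [h_exp, mul_min_of_nonneg (B / ρ / t) (t / (B / ρ))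
    (show 0 ≤ B ^ 2 * ρ ^ (m + 1) by positivity)]
  by_cases h : B / t ≤ ρ
  · have h_eq : t ^ 2 * (B / t) ^ (3 + m) = B ^ 2 * ((B / t) ^ m * (B / t)) := by
      rw [pow_add]
      field_simp
    refine le_min ?_ ?_
    · refine (mul_le_mul_of_nonneg_left (min_le_left _ _) (by positivity)).trans ?_
      rw [h_eq]
      calc B ^ 2 * ((B / t) ^ m * (B / t)) ≤ B ^ 2 * (ρ ^ m * (B / t)) := by gcongr
        _ = B ^ 2 * ρ ^ (m + 1) * (B / ρ / t) := by
          field_simp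
          ring
    · refine (mul_le_mul_of_nonneg_left (min_le_left _ _) (by positivity)).trans ?_
      rw [h_eq]
      calc B ^ 2 * ((B / t) ^ m * (B / t)) ≤ B ^ 2 * (ρ ^ m * ρ) := by gcongr
        _ = B ^ 2 * ρ ^ (m + 1) * 1 := by ring
        _ ≤ B ^ 2 * ρ ^ (m + 1) * (t / (B / ρ)) := by
          gcongr
          rw [one_le_div (by positivity), div_le_iff₀ hρ]
          rw [div_le_iff₀ ht] at h
          linarith
  · have h' : ρ * t < B := by
      rw [not_le, lt_div_iff₀ ht] at h
      exact h
    refine le_min ?_ ?_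
    · refine (mul_le_mul_of_nonneg_left (min_le_right _ _) (by positivity)).trans ?_
      calc t ^ 2 * ρ ^ (3 + m) = (ρ * t) ^ 2 * ρ ^ (m + 1) * 1 := by ring
        _ ≤ B ^ 2 * ρ ^ (m + 1) * (B / ρ / t) := by
          gcongr
          rw [one_le_div ht, le_div_iff₀ hρ]
          linarith
    · refine (mul_le_mul_of_nonneg_left (min_le_right _ _) (by positivity)).trans ?_
      calc t ^ 2 * ρ ^ (3 + m) = (ρ * t) * (ρ ^ (m + 1) * (ρ * t)) := by ring
        _ ≤ B * (ρ ^ (m + 1) * (ρ * t)) := by gcongr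
        _ = B ^ 2 * ρ ^ (m + 1) * (t / (B / ρ)) := by
          field_simp

lemma min_div_zpow_le {r : ℝ} {i : ℤ} (hi : (2 : ℝ) ^ i ≤ r) (hi' : r < 2 ^ (i + 1))
    (k : ℤ) : min (r / 2 ^ k) (2 ^ k / r) ≤ 2 * (1 / 2 : ℝ) ^ (k - i).natAbs := by
  have hr : 0 < r := (zpow_pos two_pos i).trans_le hi
  rcases le_total i k with h | h
  · obtain ⟨m, rfl⟩ := Int.le.dest h
    refine (min_le_left _ _).trans ?_
    rw [add_sub_cancel_left, Int.natAbs_natCast, div_le_iff₀ (by positivity),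
      zpow_add₀ two_ne_zero, zpow_natCast, one_div_pow]
    rw [zpow_add_one₀ two_ne_zero] at hi'
    field_simp
    linarith
  · obtain ⟨m, rfl⟩ := Int.le.dest h
    refine (min_le_right _ _).trans ?_
    rw [show k - (k + m) = -(m : ℤ) by ring, Int.natAbs_neg, Int.natAbs_natCast,
      div_le_iff₀ hr, one_div_pow]
    rw [zpow_add₀ two_ne_zero, zpow_natCast] at hi
    field_simp
    have : (0 : ℝ) < 2 ^ k := by positivity
    linarith

lemma tsum_ofReal_half_pow_natAbs_ne_top :
    ∑' k : ℤ, ENNReal.ofReal ((1 / 2 : ℝ) ^ k.natAbs) ≠ ⊤ := by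
  refine Summable.tsum_ofReal_ne_top (Summable.of_nat_of_neg ?_ ?_) <;>
  · simpa using summable_geometric_two

lemma exists_setLIntegral_dyadicMajorant_le {n : ℕ} (hn : 3 ≤ n) {B : ℝ} (hB : 0 < B) :
    ∃ K : NNReal, ∀ b : EuclideanSpace ℝ (Fin n) → EuclideanSpace ℝ (Fin n),
      weakLn n b ≤ ENNReal.ofReal B → ∀ E : Set (EuclideanSpace ℝ (Fin n)), volume E ≠ ⊤ →
      ∫⁻ x in E, dyadicMajorant b x ≤ K * volume E ^ (((n : ℝ) - 2) / n) := by
  have hn₀ : n ≠ 0 := by omega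
  set T := ∑' k : ℤ, ENNReal.ofReal ((1 / 2 : ℝ) ^ k.natAbs) with hT
  refine ⟨Real.toNNReal (8 * B ^ 2) * T.toNNReal, fun b hb E hE => ?_⟩
  push_cast
  rw [ENNReal.coe_toNNReal tsum_ofReal_half_pow_natAbs_ne_top]
  rcases eq_or_ne (volume E) 0 with hE₀ | hE₀
  · rw [setLIntegral_measure_zero _ _ hE₀]
    exact zero_le
  set m := (volume E).toReal with hm
  have hm_pos : 0 < m := ENNReal.toReal_pos hE₀ hE
  set ρ := m ^ ((n : ℝ)⁻¹) with hρ
  have hρ_pos : 0 < ρ := Real.rpow_pos_of_pos hm_pos _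
  have hρ_pow : ρ ^ n = m := Real.rpow_inv_natCast_pow hm_pos.le hn₀
  have h_vol : volume E = ENNReal.ofReal (ρ ^ n) := by
    rw [hρ_pow, ENNReal.ofReal_toReal hE]
  have h_rpow : volume E ^ (((n : ℝ) - 2) / n) = ENNReal.ofReal (ρ ^ (n - 2)) := by
    rw [h_vol, ENNReal.ofReal_rpow_of_pos (by positivity), hρ_pow, hρ, ← Real.rpow_natCast,
      ← Real.rpow_mul hm_pos.le, Nat.cast_sub (by omega), Nat.cast_two, mul_comm, div_eq_mul_inv]
  obtain ⟨i, hi, hi'⟩ := _root_.exists_mem_Ico_zpow (div_pos hB hρ_pos) (one_lt_two (α := ℝ))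
  have h_term : ∀ k : ℤ, ∫⁻ x in E, (toMeasurable volume {y | (2 : ℝ) ^ k < ‖b y‖}).indicator
      (fun _ => ENNReal.ofReal (4 * ((2 : ℝ) ^ k) ^ 2)) x ≤
      ENNReal.ofReal (8 * B ^ 2) * ENNReal.ofReal (ρ ^ (n - 2)) *
        ENNReal.ofReal ((1 / 2 : ℝ) ^ (k - i).natAbs) := by
    intro k
    have hk : (0 : ℝ) < 2 ^ k := by positivity
    have h_meas : volume.restrict E (toMeasurable volume {y | (2 : ℝ) ^ k < ‖b y‖}) ≤
        ENNReal.ofReal (min ((B / 2 ^ k) ^ n) (ρ ^ n)) := by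
      rw [ENNReal.ofReal_min]
      refine le_min ((Measure.restrict_apply_le _ _).trans ?_) ?_
      · rw [measure_toMeasurable]
        exact measure_superlevel_le_of_weakLn_le hn₀ hB.le hb hk
      · rw [← h_vol]
        exact (measure_mono (Set.subset_univ _)).trans_eq (Measure.restrict_apply_univ _)
    rw [lintegral_indicator_const (measurableSet_toMeasurable _ _)]
    refine (mul_le_mul_right h_meas _).trans ?_
    rw [← ENNReal.ofReal_mul (by positivity), ← ENNReal.ofReal_mul (by positivity),
      ← ENNReal.ofReal_mul (by positivity)]
    refine ENNReal.ofReal_le_ofReal ?_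
    calc 4 * ((2 : ℝ) ^ k) ^ 2 * min ((B / 2 ^ k) ^ n) (ρ ^ n)
        = 4 * (((2 : ℝ) ^ k) ^ 2 * min ((B / 2 ^ k) ^ n) (ρ ^ n)) := by ring
      _ ≤ 4 * (B ^ 2 * ρ ^ (n - 2) * (2 * (1 / 2 : ℝ) ^ (k - i).natAbs)) := by
          refine mul_le_mul_of_nonneg_left ?_ zero_le_four
          exact (sq_mul_min_div_pow_le hn hB hρ_pos hk).trans
            (mul_le_mul_of_nonneg_left (min_div_zpow_le hi hi' k) (by positivity))
      _ = _ := by ring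
  calc ∫⁻ x in E, dyadicMajorant b x
      = ∑' k : ℤ, ∫⁻ x in E, (toMeasurable volume {y | (2 : ℝ) ^ k < ‖b y‖}).indicator
          (fun _ => ENNReal.ofReal (4 * ((2 : ℝ) ^ k) ^ 2)) x :=
        lintegral_tsum fun k =>
          (measurable_const.indicator (measurableSet_toMeasurable _ _)).aemeasurable
    _ ≤ ∑' k : ℤ, ENNReal.ofReal (8 * B ^ 2) * ENNReal.ofReal (ρ ^ (n - 2)) *
        ENNReal.ofReal ((1 / 2 : ℝ) ^ (k - i).natAbs) := ENNReal.tsum_le_tsum h_term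
    _ = ENNReal.ofReal (8 * B ^ 2) * ENNReal.ofReal (ρ ^ (n - 2)) * T := by
        rw [ENNReal.tsum_mul_left, hT]
        congr 1
        exact (Equiv.subRight i).tsum_eq fun k : ℤ => ENNReal.ofReal ((1 / 2 : ℝ) ^ k.natAbs)
    _ = _ := by
        rw [h_rpow, ENNReal.ofReal]
        ring

lemma exists_lintegral_dyadicMajorant_mul_sq_le {n : ℕ} (hn : 3 ≤ n) {B : ℝ} (hB : 0 < B) :
    ∃ K : NNReal, ∀ b : EuclideanSpace ℝ (Fin n) → EuclideanSpace ℝ (Fin n),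
      weakLn n b ≤ ENNReal.ofReal B →
      ∀ v : EuclideanSpace ℝ (Fin n) → ℂ, ContDiff ℝ 1 v → HasCompactSupport v →
      ∫⁻ x, dyadicMajorant b x * ‖v x‖ₑ ^ 2 ≤ K * ∫⁻ x, gradNormSq v x := by
  obtain ⟨S, hS⟩ := exists_measure_superlevel_rpow_le hn
  obtain ⟨K, hK⟩ := exists_setLIntegral_dyadicMajorant_le hn hB
  refine ⟨16 * K * S, fun b hb v hv hv_supp => ?_⟩
  let R : ℤ → Set (EuclideanSpace ℝ (Fin n)) :=
    fun j => {x | (2 : ℝ) ^ j ≤ ‖v x‖ ∧ ‖v x‖ < 2 * 2 ^ j}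
  have hR_meas : ∀ j, MeasurableSet (R j) := fun j =>
    (measurableSet_le measurable_const hv.continuous.norm.measurable).inter
      (measurableSet_lt hv.continuous.norm.measurable measurable_const)
  have hR_lt : ∀ {i j : ℤ} {x}, x ∈ R i → x ∈ R j → i < j + 1 := by
    intro i j x hi hj
    have h := hi.1.trans_lt hj.2
    rw [mul_comm, ← zpow_add_one₀ two_ne_zero] at h
    exact (zpow_lt_zpow_iff_right₀ _root_.one_lt_two).1 h
  have hR_disj : Pairwise (Function.onFun Disjoint R) := fun i j hij =>
    Set.disjoint_left.2 fun x hi hj => hij <|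
    le_antisymm (Int.lt_add_one_iff.1 (hR_lt hi hj)) (Int.lt_add_one_iff.1 (hR_lt hj hi))
  have h_supp : Function.support (fun x => dyadicMajorant b x * ‖v x‖ₑ ^ 2) ⊆ ⋃ j, R j := by
    intro x hx
    have hvx : 0 < ‖v x‖ := norm_pos_iff.2 fun h => hx (by simp [h])
    obtain ⟨j, hj, hj'⟩ := _root_.exists_mem_Ico_zpow hvx (one_lt_two (α := ℝ))
    refine Set.mem_iUnion.2 ⟨j, hj, ?_⟩
    rwa [zpow_add_one₀ two_ne_zero, mul_comm] at hj'
  have h_piece : ∀ j, ∫⁻ x in R j, dyadicMajorant b x * ‖v x‖ₑ ^ 2 ≤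
      16 * K * S * ∫⁻ x in R (j - 1), gradNormSq v x := by
    intro j
    have hj : (0 : ℝ) < 2 ^ j := by positivity
    have hj_succ : (2 : ℝ) * 2 ^ (j - 1) = 2 ^ j := by
      rw [zpow_sub_one₀ two_ne_zero]
      field_simp
    have h_fin : volume {x | (2 : ℝ) * 2 ^ (j - 1) ≤ ‖v x‖} ≠ ⊤ := by
      refine ((measure_mono ?_).trans_lt hv_supp.isCompact.measure_lt_top).ne
      intro x hx
      rw [hj_succ] at hx
      exact subset_tsupport v (norm_pos_iff.1 (hj.trans_le hx))
    calc ∫⁻ x in R j, dyadicMajorant b x * ‖v x‖ₑ ^ 2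
        ≤ ∫⁻ x in R j, dyadicMajorant b x * ENNReal.ofReal ((2 * 2 ^ j) ^ 2) := by
          refine setLIntegral_mono' (hR_meas j) fun x hx => ?_
          gcongr
          rw [← ofReal_norm, ← ENNReal.ofReal_pow (norm_nonneg _)]
          exact ENNReal.ofReal_le_ofReal (pow_le_pow_left₀ (norm_nonneg _) hx.2.le 2)
      _ = ENNReal.ofReal ((2 * 2 ^ j) ^ 2) * ∫⁻ x in R j, dyadicMajorant b x := by
          rw [lintegral_mul_const' _ _ ENNReal.ofReal_ne_top, mul_comm]
      _ ≤ ENNReal.ofReal ((2 * 2 ^ j) ^ 2) *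
          ∫⁻ x in {x | (2 : ℝ) * 2 ^ (j - 1) ≤ ‖v x‖}, dyadicMajorant b x := by
          gcongr
          intro x hx
          exact hj_succ.trans_le hx.1
      _ ≤ ENNReal.ofReal ((2 * 2 ^ j) ^ 2) *
          (K * (S * ENNReal.ofReal (1 / (2 ^ (j - 1)) ^ 2) *
            ∫⁻ x in R (j - 1), gradNormSq v x)) := by
          gcongr
          refine (hK b hb _ h_fin).trans ?_
          gcongr
          exact hS v hv hv_supp _ (by positivity)
      _ = ENNReal.ofReal ((2 * 2 ^ j) ^ 2) * ENNReal.ofReal (1 / (2 ^ (j - 1)) ^ 2) * K * S *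
            ∫⁻ x in R (j - 1), gradNormSq v x := by ring
      _ = _ := by
          rw [← ENNReal.ofReal_mul (by positivity), ← hj_succ]
          congr 3
          rw [← ENNReal.ofReal_ofNat 16]
          congr 1
          field_simp
          norm_num
  calc ∫⁻ x, dyadicMajorant b x * ‖v x‖ₑ ^ 2
      = ∑' j, ∫⁻ x in R j, dyadicMajorant b x * ‖v x‖ₑ ^ 2 := by
        rw [← lintegral_iUnion hR_meas hR_disj, setLIntegral_eq_of_support_subset h_supp]
    _ ≤ ∑' j, 16 * K * S * ∫⁻ x in R (j - 1), gradNormSq v x := ENNReal.tsum_le_tsum h_piece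
    _ = 16 * K * S * ∑' j, ∫⁻ x in R j, gradNormSq v x := by
        rw [ENNReal.tsum_mul_left]
        congr 1
        exact (Equiv.subRight (1 : ℤ)).tsum_eq fun j => ∫⁻ x in R j, gradNormSq v x
    _ ≤ _ := by
        rw [← lintegral_iUnion hR_meas hR_disj]
        push_cast
        gcongr
        exact Measure.restrict_le_self

/-- The diamagnetic inequality `|∇|v|| ≤ |∇v + i b v|`. -/
lemma gradNormSq_le_magnetic {n : ℕ} (v : EuclideanSpace ℝ (Fin n) → ℂ)
    (x β : EuclideanSpace ℝ (Fin n)) :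
    gradNormSq v x ≤ ∑ j, ‖fderiv ℝ v x (EuclideanSpace.single j 1)
      + Complex.I * (β j : ℝ) * v x‖ₑ ^ 2 := by
  refine Finset.sum_le_sum fun j _ => ?_
  set w := fderiv ℝ v x (EuclideanSpace.single j 1)
  have h_inner : inner ℝ (v x) w = inner ℝ (v x) (w + Complex.I * (β j : ℝ) * v x) := by
    simp only [Complex.inner, Complex.mul_re, Complex.add_re, Complex.add_im, Complex.mul_im,
      Complex.conj_re, Complex.conj_im, Complex.I_re, Complex.I_im, Complex.ofReal_re,
      Complex.ofReal_im]
    ring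
  gcongr
  rw [h_inner, enorm_le_iff_norm_le, norm_div, norm_norm]
  exact div_le_of_le_mul₀ (norm_nonneg _) (norm_nonneg _)
    ((norm_inner_le_norm _ _).trans_eq (mul_comm _ _))

lemma enorm_add_sq_le (z w : ℂ) : ‖z + w‖ₑ ^ 2 ≤ 2 * ‖z‖ₑ ^ 2 + 2 * ‖w‖ₑ ^ 2 := by
  have h : ‖z + w‖ ^ 2 ≤ 2 * ‖z‖ ^ 2 + 2 * ‖w‖ ^ 2 := by
    nlinarith [norm_add_le z w, norm_nonneg (z + w), sq_nonneg (‖z‖ - ‖w‖)]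
  have := ENNReal.ofReal_le_ofReal h
  rwa [ENNReal.ofReal_add (by positivity) (by positivity), ENNReal.ofReal_mul zero_le_two,
    ENNReal.ofReal_mul zero_le_two, ENNReal.ofReal_pow (norm_nonneg _),
    ENNReal.ofReal_pow (norm_nonneg _), ENNReal.ofReal_pow (norm_nonneg _), ofReal_norm,
    ofReal_norm, ofReal_norm, ENNReal.ofReal_ofNat] at this

lemma sum_enorm_sq_potential {n : ℕ} (β : EuclideanSpace ℝ (Fin n)) (z : ℂ) :
    ∑ j, ‖Complex.I * (β j : ℝ) * z‖ₑ ^ 2 = ‖β‖ₑ ^ 2 * ‖z‖ₑ ^ 2 := by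
  have h : ‖β‖ₑ ^ 2 = ∑ j, ‖β j‖ₑ ^ 2 := by
    simp only [← ofReal_norm, ← ENNReal.ofReal_pow (norm_nonneg _)]
    rw [EuclideanSpace.norm_sq_eq, ENNReal.ofReal_sum_of_nonneg fun _ _ => sq_nonneg _]
  rw [h, Finset.sum_mul]
  refine Finset.sum_congr rfl fun j _ => ?_
  rw [← mul_pow]
  congr 1
  simp only [← ofReal_norm]
  rw [← ENNReal.ofReal_mul (norm_nonneg _), norm_mul, norm_mul, Complex.norm_I, one_mul,
    Complex.norm_real]

lemma sum_enorm_magnetic_sq_le {n : ℕ} (p : Fin n → ℂ) (β : EuclideanSpace ℝ (Fin n)) (z : ℂ) :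
    ∑ j, ‖p j + Complex.I * (β j : ℝ) * z‖ₑ ^ 2 ≤
      2 * ∑ j, ‖p j‖ₑ ^ 2 + 2 * (‖β‖ₑ ^ 2 * ‖z‖ₑ ^ 2) := by
  rw [← sum_enorm_sq_potential, Finset.mul_sum, Finset.mul_sum, ← Finset.sum_add_distrib]
  exact Finset.sum_le_sum fun j _ => enorm_add_sq_le _ _

lemma sum_enorm_sq_le_magnetic {n : ℕ} (p : Fin n → ℂ) (β : EuclideanSpace ℝ (Fin n)) (z : ℂ) :
    ∑ j, ‖p j‖ₑ ^ 2 ≤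
      2 * ∑ j, ‖p j + Complex.I * (β j : ℝ) * z‖ₑ ^ 2 + 2 * (‖β‖ₑ ^ 2 * ‖z‖ₑ ^ 2) := by
  rw [← sum_enorm_sq_potential, Finset.mul_sum, Finset.mul_sum, ← Finset.sum_add_distrib]
  refine Finset.sum_le_sum fun j _ => ?_
  simpa only [add_neg_cancel_right, enorm_neg] using
    enorm_add_sq_le (p j + Complex.I * (β j : ℝ) * z) (-(Complex.I * (β j : ℝ) * z))

/-- If `f ≤ 2 g + 2 w` with `w` measurable and `∫ w ≤ K ∫ g`, then the square root of `∫ f` is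
controlled by that of `∫ g`; neither `f` nor `g` has to be measurable. -/
lemma lintegral_rpow_half_le_of_le_add {α : Type*} [MeasurableSpace α] {μ : Measure α}
    {f g w : α → ℝ≥0∞} (hw : Measurable w) (K : NNReal) (hfg : ∀ x, f x ≤ 2 * g x + 2 * w x)
    (hwg : ∫⁻ x, w x ∂μ ≤ K * ∫⁻ x, g x ∂μ) :
    (∫⁻ x, f x ∂μ) ^ (1 / 2 : ℝ) ≤
      ENNReal.ofReal (2 + 2 * K) * (∫⁻ x, g x ∂μ) ^ (1 / 2 : ℝ) := by
  have h_one : (1 : ℝ≥0∞) ≤ ENNReal.ofReal (2 + 2 * K) := by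
    rw [ENNReal.one_le_ofReal]
    linarith [K.coe_nonneg]
  have h_const : ENNReal.ofReal (2 + 2 * K) = 2 + 2 * (K : ℝ≥0∞) := by
    rw [ENNReal.ofReal_add zero_le_two (by positivity), ENNReal.ofReal_mul zero_le_two,
      ENNReal.ofReal_ofNat, ENNReal.ofReal_coe_nnreal]
  calc (∫⁻ x, f x ∂μ) ^ (1 / 2 : ℝ)
      ≤ (ENNReal.ofReal (2 + 2 * K) * ∫⁻ x, g x ∂μ) ^ (1 / 2 : ℝ) := by
        gcongr
        calc ∫⁻ x, f x ∂μ ≤ ∫⁻ x, 2 * g x + 2 * w x ∂μ := lintegral_mono hfg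
          _ = 2 * ∫⁻ x, g x ∂μ + 2 * ∫⁻ x, w x ∂μ := by
            rw [lintegral_add_right _ (hw.const_mul 2), lintegral_const_mul' _ _ (by simp),
              lintegral_const_mul' _ _ (by simp)]
          _ ≤ 2 * ∫⁻ x, g x ∂μ + 2 * (K * ∫⁻ x, g x ∂μ) := by gcongr
          _ = _ := by
            rw [h_const]
            ring
    _ = ENNReal.ofReal (2 + 2 * K) ^ (1 / 2 : ℝ) * (∫⁻ x, g x ∂μ) ^ (1 / 2 : ℝ) :=
        ENNReal.mul_rpow_of_nonneg _ _ (by norm_num)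
    _ ≤ _ := by
        gcongr
        exact (ENNReal.rpow_le_rpow_of_exponent_le h_one (by norm_num)).trans_eq
          (ENNReal.rpow_one _)

/-- For `n ≥ 3` and `b ∈ L^{n,∞}`, the magnetic and free gradients have equivalent `L²` norms on
test functions, with a constant depending only on `n` and on (a bound `B` for) `‖b‖_{L^{n,∞}}`. -/
theorem stmt_11 (n : ℕ) (hn : 3 ≤ n) (B : NNReal) :
    ∃ C > (0 : ℝ), ∀ (Ω : Set (EuclideanSpace ℝ (Fin n))), IsOpen Ω →
      ∀ (b : EuclideanSpace ℝ (Fin n) → EuclideanSpace ℝ (Fin n)), weakLn n b ≤ B →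
      ∀ (v : EuclideanSpace ℝ (Fin n) → ℂ), ContDiff ℝ (⊤ : ℕ∞) v → HasCompactSupport v →
        tsupport v ⊆ Ω →
        ((∫⁻ x in Ω, ∑ j, (‖fderiv ℝ v x (EuclideanSpace.single j 1)
              + Complex.I * (b x j : ℝ) * v x‖₊ : ℝ≥0∞) ^ 2) ^ (1 / 2 : ℝ)
            ≤ ENNReal.ofReal C *
              (∫⁻ x in Ω, ∑ j,
                  (‖fderiv ℝ v x (EuclideanSpace.single j 1)‖₊ : ℝ≥0∞) ^ 2) ^ (1 / 2 : ℝ))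
        ∧ ((∫⁻ x in Ω, ∑ j,
              (‖fderiv ℝ v x (EuclideanSpace.single j 1)‖₊ : ℝ≥0∞) ^ 2) ^ (1 / 2 : ℝ)
            ≤ ENNReal.ofReal C *
              (∫⁻ x in Ω, ∑ j, (‖fderiv ℝ v x (EuclideanSpace.single j 1)
                  + Complex.I * (b x j : ℝ) * v x‖₊ : ℝ≥0∞) ^ 2) ^ (1 / 2 : ℝ)) := by
  have hB : (0 : ℝ) < B + 1 := by positivity
  obtain ⟨K, hK⟩ := exists_lintegral_dyadicMajorant_mul_sq_le hn hB
  refine ⟨2 + 2 * K, by positivity, fun Ω _ b hb v hv hv_supp hvΩ => ?_⟩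
  have hv₁ : ContDiff ℝ 1 v := hv.of_le (by exact_mod_cast le_top)
  have hb' : weakLn n b ≤ ENNReal.ofReal (B + 1) := by
    refine hb.trans ?_
    rw [← ENNReal.ofReal_coe_nnreal]
    exact ENNReal.ofReal_le_ofReal (by linarith)
  have h_supp : Function.support (gradNormSq v) ⊆ Ω := fun x hx =>
    hvΩ (subset_tsupport v fun h => hx (by simp [gradNormSq, h]))
  have h_hardy : ∫⁻ x in Ω, dyadicMajorant b x * ‖v x‖ₑ ^ 2 ≤
      K * ∫⁻ x in Ω, gradNormSq v x := by
    rw [setLIntegral_eq_of_support_subset h_supp]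
    exact (setLIntegral_le_lintegral _ _).trans (hK b hb' v hv₁ hv_supp)
  have h_meas : Measurable fun x => dyadicMajorant b x * ‖v x‖ₑ ^ 2 :=
    (measurable_dyadicMajorant b).mul (hv.continuous.measurable.enorm.pow_const 2)
  refine ⟨lintegral_rpow_half_le_of_le_add h_meas K (fun x => ?_) (h_hardy.trans ?_),
    lintegral_rpow_half_le_of_le_add h_meas K (fun x => ?_) (h_hardy.trans ?_)⟩
  · refine (sum_enorm_magnetic_sq_le _ (b x) (v x)).trans ?_
    gcongr
    exacts [le_rfl, enorm_sq_le_dyadicMajorant b x]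
  · gcongr with x
    simpa [enorm_eq_nnnorm] using gradNormSq_le_magnetic v x 0
  · refine (sum_enorm_sq_le_magnetic _ (b x) (v x)).trans ?_
    gcongr
    exacts [le_rfl, enorm_sq_le_dyadicMajorant b x]
  · gcongr with x
    exact gradNormSq_le_magnetic v x (b x)
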